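/- Let d ≥ 1, let u, g : ℝᵈ → ℝ be C¹ and ℤᵈ-periodic, and let z : ℝᵈ → ℝᵈ be a C² ℤᵈ-periodic vector field such that |z(x)| ≤ 1 for every x, ∫ |∇u| ≤ ∫ z · ∇u, and −div z + u = g everywhere on ℝᵈ. Then ∫ |∇(div z)|² ≤ ∫ |∇g|². -/

import Mathlib

open MeasureTheory
open scoped RealInnerProductSpace

noncomputable section

/-- The fundamental domain `[0,1)^d` of the torus, inside `ℝ^d`. -/
def UnitCube (d : ℕ) : Set (EuclideanSpace ℝ (Fin d)) :=
  {x | ∀ i, 0 ≤ x i ∧ x i < 1}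

/-- A function on `ℝ^d` is `ℤ^d`-periodic if it is invariant under translations by
integer vectors. -/
def ZdPeriodic {d : ℕ} {V : Type*} (f : EuclideanSpace ℝ (Fin d) → V) : Prop :=
  ∀ (x : EuclideanSpace ℝ (Fin d)) (m : Fin d → ℤ),
    f (x + (EuclideanSpace.equiv (Fin d) ℝ).symm (fun i => (m i : ℝ))) = f x

/-- The divergence of a vector field on `ℝ^d`. -/
noncomputable def diverg {d : ℕ}
    (z : EuclideanSpace ℝ (Fin d) → EuclideanSpace ℝ (Fin d))
    (x : EuclideanSpace ℝ (Fin d)) : ℝ :=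
  ∑ i, fderiv ℝ z x (EuclideanSpace.single i 1) i


abbrev EE (d : ℕ) := EuclideanSpace ℝ (Fin d)

lemma cube_eq (d : ℕ) : UnitCube d =
    ZSpan.fundamentalDomain (EuclideanSpace.basisFun (Fin d) ℝ).toBasis := by
  ext x
  simp [UnitCube, ZSpan.mem_fundamentalDomain]

lemma cube_meas (d : ℕ) : MeasurableSet (UnitCube d) := by
  rw [cube_eq]; exact ZSpan.fundamentalDomain_measurableSet _

lemma cube_ball (d : ℕ) : ∃ R : ℝ, ∀ x ∈ UnitCube d, ‖x‖ ≤ R := by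
  rw [cube_eq]
  exact isBounded_iff_forall_norm_le.1 (ZSpan.fundamentalDomain_isBounded _)

lemma cube_int {d : ℕ} {f : EE d → ℝ} (hf : Continuous f) :
    IntegrableOn f (UnitCube d) := by
  obtain ⟨R, hR⟩ := cube_ball d
  refine (hf.continuousOn.integrableOn_compact (isCompact_closedBall (0 : EE d) R)).mono_set ?_
  intro x hx
  simpa using hR x hx

lemma cube_trans {d : ℕ} {f : EE d → ℝ} (hf : ZdPeriodic f) (h : EE d) :
    ∫ x in UnitCube d, f (x + h) = ∫ x in UnitCube d, f x := by
  have hD := ZSpan.isAddFundamentalDomain' (EuclideanSpace.basisFun (Fin d) ℝ).toBasis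
    (volume : Measure (EE d))
  rw [← cube_eq] at hD
  have hD2 := hD.vadd_of_comm h
  have : Countable (Submodule.span ℤ
      (Set.range (EuclideanSpace.basisFun (Fin d) ℝ).toBasis)).toAddSubgroup :=
    inferInstanceAs (Countable (Submodule.span ℤ
      (Set.range (EuclideanSpace.basisFun (Fin d) ℝ).toBasis)))
  have key := hD.setIntegral_eq hD2 (f := f) (by
    rintro ⟨m, hm⟩ x
    have hm' : m ∈ Submodule.span ℤ (Set.range (EuclideanSpace.basisFun (Fin d) ℝ).toBasis) := hm
    rw [Module.Basis.mem_span_iff_repr_mem] at hm'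
    choose k hk using hm'
    have : m = (EuclideanSpace.equiv (Fin d) ℝ).symm (fun i => (k i : ℝ)) := by
      ext i
      have := hk i
      simp at this
      simp [this]
    have h2 := hf x k
    rw [← this, add_comm] at h2
    exact h2)
  rw [key]
  have h3 := (measurePreserving_add_right (volume : Measure (EE d)) h).setIntegral_image_emb
    (measurableEmbedding_addRight h) f (UnitCube d)
  rw [← h3]
  congr 2
  ext x
  simp only [Set.mem_vadd_set, Set.mem_image, vadd_eq_add, add_comm]

lemma dq_bound {d : ℕ} {f : EE d → ℝ} (hf : ContDiff ℝ 1 f) (e : EE d) :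
    ∃ C : ℝ, 0 ≤ C ∧ ∀ x ∈ UnitCube d, ∀ t : ℝ, 0 < t → t ≤ 1 →
      ‖t⁻¹ • (f (x + t • e) - f x)‖ ≤ C := by
  obtain ⟨R, hR⟩ := cube_ball d
  obtain ⟨C, hC⟩ := (isCompact_closedBall (0 : EE d) (R + ‖e‖)).exists_bound_of_continuousOn
    (hf.continuous_fderiv (by norm_num)).continuousOn
  refine ⟨|C| * ‖e‖, by positivity, fun x hx t ht ht1 => ?_⟩
  have hx' := hR x hx
  have hte : ‖t • e‖ ≤ ‖e‖ := by
    rw [norm_smul, Real.norm_of_nonneg ht.le]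
    exact mul_le_of_le_one_left (norm_nonneg _) ht1
  have := (convex_closedBall (0 : EE d) (R + ‖e‖)).norm_image_sub_le_of_norm_fderiv_le
    (𝕜 := ℝ) (f := f) (x := x) (y := x + t • e) (C := |C|)
    (fun y _ => (hf.differentiable (by norm_num)) y) (fun y hy => (hC y hy).trans (le_abs_self _))
    (by simp; linarith [norm_nonneg e])
    (by simp; linarith [norm_add_le x (t • e)])
  rw [norm_smul, norm_inv, Real.norm_of_nonneg ht.le, inv_mul_le_iff₀ ht]
  refine this.trans (le_of_eq ?_)
  rw [add_sub_cancel_left, norm_smul, Real.norm_of_nonneg ht.le]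
  ring

lemma dq_lim {d : ℕ} {f k : EE d → ℝ} (hf : ContDiff ℝ 1 f) (hk : ContDiff ℝ 1 k) (e : EE d) :
    Filter.Tendsto (fun n : ℕ => ∫ x in UnitCube d,
      ((1 / ((n : ℝ) + 1))⁻¹ • (f (x + (1 / ((n : ℝ) + 1)) • e) - f x)) *
      ((1 / ((n : ℝ) + 1))⁻¹ • (k (x + (1 / ((n : ℝ) + 1)) • e) - k x))) Filter.atTop
      (nhds (∫ x in UnitCube d, fderiv ℝ f x e * fderiv ℝ k x e)) := by
  obtain ⟨C, hC0, hC⟩ := dq_bound hf e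
  obtain ⟨K, hK0, hK⟩ := dq_bound hk e
  have hfc := hf.continuous
  have hkc := hk.continuous
  have ht0 : ∀ n : ℕ, 0 < 1 / ((n : ℝ) + 1) := fun n => by positivity
  have ht1 : ∀ n : ℕ, 1 / ((n : ℝ) + 1) ≤ 1 := fun n => by
    rw [div_le_one (by positivity)]; linarith [(Nat.cast_nonneg n : (0 : ℝ) ≤ n)]
  refine tendsto_integral_of_dominated_convergence (fun _ => C * K) ?_ ?_ ?_ ?_
  · intro n
    exact Continuous.aestronglyMeasurable (by fun_prop)
  · exact cube_int continuous_const
  · intro n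
    filter_upwards [ae_restrict_mem (cube_meas d)] with x hx
    rw [norm_mul]
    exact mul_le_mul (hC x hx _ (ht0 n) (ht1 n)) (hK x hx _ (ht0 n) (ht1 n)) (norm_nonneg _) hC0
  · refine Filter.Eventually.of_forall fun x => ?_
    have hs : Filter.Tendsto (fun n : ℕ => 1 / ((n : ℝ) + 1)) Filter.atTop
        (nhdsWithin 0 (Set.Ioi 0)) :=
      tendsto_nhdsWithin_iff.2 ⟨tendsto_one_div_add_atTop_nhds_zero_nat,
        Filter.Eventually.of_forall fun n => ht0 n⟩
    have h1 := (((hf.differentiable (by norm_num)) x).hasFDerivAt.hasLineDerivAt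
      e).tendsto_slope_zero_right.comp hs
    have h2 := (((hk.differentiable (by norm_num)) x).hasFDerivAt.hasLineDerivAt
      e).tendsto_slope_zero_right.comp hs
    exact h1.mul h2

lemma int_fderiv {d : ℕ} {f : EE d → ℝ} (hf : ContDiff ℝ 1 f) (hp : ZdPeriodic f) (i : Fin d) :
    ∫ x in UnitCube d, fderiv ℝ f x (EuclideanSpace.single i 1) = 0 := by
  have hk : ContDiff ℝ 1 (fun x : EE d => x i) := by fun_prop
  have := dq_lim hf hk (EuclideanSpace.single i 1)
  have hd : ∀ x : EE d, fderiv ℝ (fun x : EE d => x i) x (EuclideanSpace.single i 1) = 1 := by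
    intro x
    have : HasFDerivAt (fun x : EE d => x i) (EuclideanSpace.proj i : EE d →L[ℝ] ℝ) x :=
      (EuclideanSpace.proj i : EE d →L[ℝ] ℝ).hasFDerivAt
    rw [this.fderiv]; simp
  simp only [hd, mul_one] at this
  refine tendsto_nhds_unique this ?_
  refine tendsto_const_nhds.congr fun n => ?_
  have hn : (1 / ((n : ℝ) + 1)) ≠ 0 := by positivity
  generalize 1 / ((n : ℝ) + 1) = t at hn
  have hfc := hf.continuous
  have : ∀ x : EE d, (t⁻¹ • (f (x + t • EuclideanSpace.single i 1) - f x)) *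
      (t⁻¹ • ((x + t • EuclideanSpace.single i (1 : ℝ)) i - x i)) =
      t⁻¹ * (f (x + t • EuclideanSpace.single i 1) - f x) := by
    intro x; simp [hn]
  simp only [this]
  rw [integral_const_mul, integral_sub (cube_int (by fun_prop)) (cube_int hfc), cube_trans hp]
  simp

lemma per_shift {d : ℕ} {V : Type*} {f : EE d → V} (hf : ZdPeriodic f) (h : EE d) :
    ZdPeriodic (fun x => f (x + h)) := by
  intro x m
  have := hf (x + h) m
  simp only
  rw [← this]; congr 1; abel

lemma inner_coord {d : ℕ} (v w : EE d) : ⟪v, w⟫ =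
    ∑ i, v i * ⟪w, EuclideanSpace.single i (1 : ℝ)⟫ := by
  simp [PiLp.inner_apply, mul_comm]

lemma int_parts {d : ℕ} {u : EE d → ℝ} {z : EE d → EE d} (hu : ContDiff ℝ 1 u)
    (hz : ContDiff ℝ 1 z) (hup : ZdPeriodic u) (hzp : ZdPeriodic z) :
    ∫ x in UnitCube d, ⟪z x, gradient u x⟫ = - ∫ x in UnitCube d, diverg z x * u x := by
  have hzi : ∀ i, ContDiff ℝ 1 (fun x => z x i) := fun i => by fun_prop
  have hder : ∀ i x, fderiv ℝ (fun x => z x i * u x) x (EuclideanSpace.single i 1) =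
      z x i * fderiv ℝ u x (EuclideanSpace.single i 1) +
        fderiv ℝ z x (EuclideanSpace.single i 1) i * u x := by
    intro i x
    have h1 : HasFDerivAt (fun x => z x i)
        ((EuclideanSpace.proj i : EE d →L[ℝ] ℝ).comp (fderiv ℝ z x)) x :=
      (EuclideanSpace.proj i : EE d →L[ℝ] ℝ).hasFDerivAt.comp x
        ((hz.differentiable (by norm_num)) x).hasFDerivAt
    have h2 := ((hu.differentiable (by norm_num)) x).hasFDerivAt
    have h3 : HasFDerivAt (fun x => z x i * u x) _ x := h1.mul h2
    rw [h3.fderiv]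
    simp [mul_comm]
  have hfu := hu.continuous_fderiv (by norm_num)
  have hfz := hz.continuous_fderiv (by norm_num)
  have hcu := hu.continuous
  have hcz := hz.continuous
  have h0 : ∑ i, ∫ x in UnitCube d,
      fderiv ℝ (fun x => z x i * u x) x (EuclideanSpace.single i 1) = 0 := by
    refine Finset.sum_eq_zero fun i _ => ?_
    refine int_fderiv ((hzi i).mul hu) ?_ i
    intro x m
    simp only [hup x m, hzp x m]
  simp only [hder] at h0
  rw [← integral_finsetSum] at h0
  swap
  · intro i _
    exact cube_int (by fun_prop)
  rw [eq_neg_iff_add_eq_zero, ← integral_add, ← h0]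
  · congr 1
    ext x
    rw [Finset.sum_add_distrib, ← Finset.sum_mul, inner_coord]
    simp only [inner_gradient_left]
    rfl
  · simp only [inner_coord, inner_gradient_left]
    exact cube_int (by fun_prop)
  · unfold diverg
    exact cube_int (by fun_prop)

lemma grad_cont {d : ℕ} {u : EE d → ℝ} (hu : ContDiff ℝ 1 u) : Continuous (gradient u) := by
  have hfu := hu.continuous_fderiv (by norm_num)
  exact (InnerProductSpace.toDual ℝ (EE d)).symm.continuous.comp hfu

lemma diverg_shift {d : ℕ} (z : EE d → EE d) (h x : EE d) :
    diverg (fun y => z (y + h)) x = diverg z (x + h) := by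
  simp [diverg, fderiv_comp_add_right]

/-- estimate of Theorem 4.1 in the smooth setting: the ROF
optimality conditions `|z| ≤ 1`, `∫|∇u| ≤ ∫ z·∇u` and `-div z + u = g` imply
`∫|∇(div z)|² ≤ ∫|∇g|²`. -/
theorem rof_div_gradient_estimate (d : ℕ) (hd : 1 ≤ d)
    (u g : EuclideanSpace ℝ (Fin d) → ℝ)
    (z : EuclideanSpace ℝ (Fin d) → EuclideanSpace ℝ (Fin d))
    (hu : ContDiff ℝ 1 u) (hg : ContDiff ℝ 1 g) (hz : ContDiff ℝ 2 z)
    (huper : ZdPeriodic u) (hgper : ZdPeriodic g) (hzper : ZdPeriodic z)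
    (hz1 : ∀ x, ‖z x‖ ≤ 1)
    (hcomp : ∫ x in UnitCube d, ‖gradient u x‖ ≤
      ∫ x in UnitCube d, ⟪z x, gradient u x⟫)
    (heq : ∀ x, -diverg z x + u x = g x) :
    ∫ x in UnitCube d, ‖gradient (diverg z) x‖ ^ 2 ≤
      ∫ x in UnitCube d, ‖gradient g x‖ ^ 2 := by
  have hz' : ContDiff ℝ 1 z := hz.of_le (by norm_num)
  have hw_eq : diverg z = fun x => u x - g x := by
    funext x; linarith [heq x]
  have hw : ContDiff ℝ 1 (diverg z) := by rw [hw_eq]; exact hu.sub hg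
  have hwp : ZdPeriodic (diverg z) := by
    rw [hw_eq]; intro x m
    simp only [huper x m, hgper x m]
  have hparts : ∀ h, ∫ x in UnitCube d, ⟪z (x + h), gradient u x⟫ =
      - ∫ x in UnitCube d, diverg z (x + h) * u x := by
    intro h
    have := int_parts (z := fun x => z (x + h)) hu (by fun_prop) huper (per_shift hzper h)
    simpa only [diverg_shift] using this
  have hgu := grad_cont hu
  have hgw := grad_cont hw
  have hgg := grad_cont hg
  have hcu := hu.continuous
  have hcz := hz.continuous
  have hcw := hw.continuous
  have hmax : ∀ h, ∫ x in UnitCube d, diverg z x * u x ≤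
      ∫ x in UnitCube d, diverg z (x + h) * u x := by
    intro h
    have h1 := hparts h
    have h2 := int_parts hu hz' huper hzper
    have h3 : ∫ x in UnitCube d, ⟪z (x + h), gradient u x⟫ ≤
        ∫ x in UnitCube d, ‖gradient u x‖ := by
      refine integral_mono (cube_int (by fun_prop)) (cube_int (by fun_prop)) fun x => ?_
      refine (real_inner_le_norm _ _).trans ?_
      exact mul_le_of_le_one_left (norm_nonneg _) (hz1 _)
    linarith
  have hneg : ∀ h, ∫ x in UnitCube d,
      (diverg z (x + h) - diverg z x) * (u (x + h) - u x) ≤ 0 := by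
    intro h
    have e1 : ∫ x in UnitCube d, diverg z (x + h) * u (x + h) =
        ∫ x in UnitCube d, diverg z x * u x :=
      cube_trans (f := fun x => diverg z x * u x)
        (fun x m => by simp only [huper x m, hwp x m]) h
    have e2 : ∫ x in UnitCube d, diverg z x * u (x + h) =
        ∫ x in UnitCube d, diverg z (x + -h) * u x := by
      have := cube_trans (f := fun x => diverg z (x + -h) * u x)
        (fun x m => by simp only [huper x m, per_shift hwp (-h) x m]) h
      simpa using this
    have e3 : ∫ x in UnitCube d, (diverg z (x + h) - diverg z x) * (u (x + h) - u x) =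
        ((∫ x in UnitCube d, diverg z (x + h) * u (x + h)) -
          ∫ x in UnitCube d, diverg z (x + h) * u x) -
        ((∫ x in UnitCube d, diverg z x * u (x + h)) -
          ∫ x in UnitCube d, diverg z x * u x) := by
      rw [← integral_sub (cube_int (by fun_prop)) (cube_int (by fun_prop)),
        ← integral_sub (cube_int (by fun_prop)) (cube_int (by fun_prop)),
        ← integral_sub (cube_int (by fun_prop)) (cube_int (by fun_prop))]
      congr 1; ext x; ring
    have := hmax h
    have := hmax (-h)
    linarith
  have hpart : ∀ i, ∫ x in UnitCube d, fderiv ℝ (diverg z) x (EuclideanSpace.single i 1) *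
      fderiv ℝ u x (EuclideanSpace.single i 1) ≤ 0 := by
    intro i
    refine le_of_tendsto' (dq_lim hw hu (EuclideanSpace.single i 1)) fun n => ?_
    generalize 1 / ((n : ℝ) + 1) = t
    have : ∀ x, (t⁻¹ • (diverg z (x + t • EuclideanSpace.single i 1) - diverg z x)) *
        (t⁻¹ • (u (x + t • EuclideanSpace.single i 1) - u x)) =
        (t⁻¹) ^ 2 * ((diverg z (x + t • EuclideanSpace.single i 1) - diverg z x) *
          (u (x + t • EuclideanSpace.single i 1) - u x)) := by
      intro x; simp only [smul_eq_mul]; ring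
    simp only [this]
    rw [integral_const_mul]
    exact mul_nonpos_of_nonneg_of_nonpos (sq_nonneg _) (hneg _)
  have hfu := hu.continuous_fderiv (by norm_num)
  have hfw := hw.continuous_fderiv (by norm_num)
  have hin : ∫ x in UnitCube d, ⟪gradient (diverg z) x, gradient u x⟫ ≤ 0 := by
    have : ∀ x, ⟪gradient (diverg z) x, gradient u x⟫ =
        ∑ i, fderiv ℝ (diverg z) x (EuclideanSpace.single i 1) *
          fderiv ℝ u x (EuclideanSpace.single i 1) := by
      intro x
      rw [inner_coord]
      refine Finset.sum_congr rfl fun i _ => ?_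
      have h1 : gradient (diverg z) x i =
          fderiv ℝ (diverg z) x (EuclideanSpace.single i 1) := by
        rw [← inner_gradient_left, EuclideanSpace.inner_single_right]
        simp
      rw [inner_gradient_left, h1]
    simp only [this]
    rw [integral_finsetSum]
    swap
    · intro i _
      exact cube_int (by fun_prop)
    exact Finset.sum_nonpos fun i _ => hpart i
  have hgrad : ∀ x, gradient g x = gradient u x - gradient (diverg z) x := by
    intro x
    have hg_eq : g = fun x => u x - diverg z x := by funext y; linarith [heq y]
    have : fderiv ℝ g x = fderiv ℝ u x - fderiv ℝ (diverg z) x := by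
      conv_lhs => rw [hg_eq]
      exact fderiv_fun_sub ((hu.differentiable (by norm_num)) x)
        ((hw.differentiable (by norm_num)) x)
    simp only [gradient, this, map_sub]
  have hle : ∫ x in UnitCube d, ‖gradient (diverg z) x‖ ^ 2 ≤
      ∫ x in UnitCube d, (‖gradient g x‖ ^ 2 + 2 * ⟪gradient (diverg z) x, gradient u x⟫) := by
    refine integral_mono (cube_int (by fun_prop)) (cube_int (by fun_prop)) fun x => ?_
    simp only
    rw [hgrad, norm_sub_sq_real, real_inner_comm]
    nlinarith [sq_nonneg ‖gradient u x‖]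
  have hle2 : ∫ x in UnitCube d, (‖gradient g x‖ ^ 2 + 2 * ⟪gradient (diverg z) x, gradient u x⟫) =
      (∫ x in UnitCube d, ‖gradient g x‖ ^ 2) +
        2 * ∫ x in UnitCube d, ⟪gradient (diverg z) x, gradient u x⟫ := by
    rw [← integral_const_mul]
    exact integral_add (cube_int (by fun_prop)) (cube_int (by fun_prop))
  linarith

end
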